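/- For μ ∈ M^p define the finite measure μ^p(A) = ∫_A d(x,∂Ω)^p dμ(x). Then for μ_n, μ ∈ M^p: OT_p(μ_n, μ) → 0 if and only if μ_n^p converges weakly to μ^p (i.e., against all bounded continuous functions on Ω). -/

import Mathlib

noncomputable section

open MeasureTheory Metric Set Filter Topology ENNReal
open scoped Classical

/-- The plane with the Euclidean distance. -/
abbrev Pt : Type := EuclideanSpace ℝ (Fin 2)

/-- Build a point of the plane from coordinates. -/
def mk2 (a b : ℝ) : Pt := (WithLp.equiv 2 (Fin 2 → ℝ)).symm ![a, b]

/-- The open upper half-plane Ω = {(t₁,t₂) : t₂ > t₁}. -/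
def UHP : Set Pt := {x | x 0 < x 1}

/-- The diagonal ∂Ω = {(t,t)}. -/
def Diag : Set Pt := {x | x 0 = x 1}

/-- Ω̄ = Ω ∪ ∂Ω. -/
def UHPbar : Set Pt := UHP ∪ Diag

/-- Distance from a point to the diagonal. -/
def persDist (x : Pt) : ℝ := infDist x Diag

/-- p-th total persistence Pers_p(μ) = ∫_Ω d(x,∂Ω)^p dμ(x). -/
def Pers (p : ℝ) (μ : Measure Pt) : ℝ≥0∞ :=
  ∫⁻ x in UHP, ENNReal.ofReal (persDist x ^ p) ∂μ

/-- μ ∈ M^p : a measure supported on Ω with finite p-th persistence. -/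
def MemMp (p : ℝ) (μ : Measure Pt) : Prop := μ UHPᶜ = 0 ∧ Pers p μ < ⊤

/-- Admissible partial transport plans between μ and ν: measures on Ω̄ × Ω̄ whose
marginals restricted to Ω are μ and ν. -/
def Adm (μ ν : Measure Pt) : Set (Measure (Pt × Pt)) :=
  {π | π ((UHPbar ×ˢ UHPbar)ᶜ) = 0 ∧
    (∀ A : Set Pt, MeasurableSet A → A ⊆ UHP → π (A ×ˢ univ) = μ A) ∧
    (∀ B : Set Pt, MeasurableSet B → B ⊆ UHP → π (univ ×ˢ B) = ν B)}

/-- Cost C_p(π) = ∬ d(x,y)^p dπ(x,y). -/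
def Cost (p : ℝ) (π : Measure (Pt × Pt)) : ℝ≥0∞ :=
  ∫⁻ z, ENNReal.ofReal (dist z.1 z.2 ^ p) ∂π

/-- OT_p(μ,ν)^p, as an extended real. -/
def OTe (p : ℝ) (μ ν : Measure Pt) : ℝ≥0∞ := ⨅ π ∈ Adm μ ν, Cost p π

/-- The optimal partial transport distance OT_p(μ,ν). -/
def OT (p : ℝ) (μ ν : Measure Pt) : ℝ := (OTe p μ ν ^ (1 / p)).toReal

/-- Optimal plans. -/
def OptSet (p : ℝ) (μ ν : Measure Pt) : Set (Measure (Pt × Pt)) :=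
  {π | π ∈ Adm μ ν ∧ Cost p π = OTe p μ ν}

/-- Vague convergence of measures on Ω: convergence of integrals of continuous
functions compactly supported in Ω. -/
def VagueTendsto (μs : ℕ → Measure Pt) (μ : Measure Pt) : Prop :=
  ∀ f : Pt → ℝ, Continuous f → HasCompactSupport f → tsupport f ⊆ UHP →
    Tendsto (fun n => ∫ x, f x ∂(μs n)) atTop (𝓝 (∫ x, f x ∂μ))

/-- E_Ω = (Ω̄ × Ω̄) \ (∂Ω × ∂Ω). -/
def EOm : Set (Pt × Pt) := (UHPbar ×ˢ UHPbar) \ (Diag ×ˢ Diag)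

/-- Vague convergence of plans on E_Ω. -/
def VaguePlanTendsto (πs : ℕ → Measure (Pt × Pt)) (π : Measure (Pt × Pt)) : Prop :=
  ∀ f : Pt × Pt → ℝ, Continuous f → HasCompactSupport f → tsupport f ⊆ EOm →
    Tendsto (fun n => ∫ z, f z ∂(πs n)) atTop (𝓝 (∫ z, f z ∂π))

/-- A persistence diagram: an ℕ-valued point measure Σ_{x ∈ X} n_x δ_x with
X ⊆ Ω locally finite in Ω. -/
def IsDiagram (μ : Measure Pt) : Prop :=
  ∃ (X : Set Pt) (n : Pt → ℕ), X ⊆ UHP ∧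
    (∀ x ∈ UHP, ∃ U ∈ 𝓝 x, (X ∩ U).Finite) ∧
    μ = Measure.sum (fun x : X => (n x.1 : ℝ≥0∞) • Measure.dirac (x.1 : Pt))

/-- Support of a measure on Pt × Pt. -/
def msupp (π : Measure (Pt × Pt)) : Set (Pt × Pt) := {z | ∀ U ∈ 𝓝 z, π U ≠ 0}

/-- Support of a measure on Pt. -/
def suppM (μ : Measure Pt) : Set Pt := {x | ∀ U ∈ 𝓝 x, μ U ≠ 0}

/-- Bottleneck cost of a plan: sup of d(x,y) over the support. -/
def CostInf (π : Measure (Pt × Pt)) : ℝ≥0∞ :=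
  ⨆ z ∈ msupp π, ENNReal.ofReal (dist z.1 z.2)

/-- The bottleneck (∞) optimal partial transport distance, as extended real. -/
def OTinfE (μ ν : Measure Pt) : ℝ≥0∞ := ⨅ π ∈ Adm μ ν, CostInf π

/-- μ ∈ M^∞ : support at bounded distance from the diagonal. -/
def MemMinf (μ : Measure Pt) : Prop :=
  μ UHPᶜ = 0 ∧ ∃ C : ℝ, ∀ x ∈ suppM μ, persDist x ≤ C

/-- A partial matching between two indexed families: a bijection between
subsets of the index sets; unmatched points are sent to the diagonal. -/
structure Matching (ι κ : Type*) where
  I : Set ι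
  J : Set κ
  e : I ≃ J

/-- Cost of a partial matching for d_p (as the p-th power, extended real). -/
def mCost (p : ℝ) {ι κ : Type*} (x : ι → Pt) (y : κ → Pt) (m : Matching ι κ) : ℝ≥0∞ :=
  (∑' i : m.I, ENNReal.ofReal (dist (x i.1) (y (m.e i).1) ^ p))
  + (∑' i : ↥(m.Iᶜ), ENNReal.ofReal (persDist (x i.1) ^ p))
  + (∑' j : ↥(m.Jᶜ), ENNReal.ofReal (persDist (y j.1) ^ p))

/-- Bottleneck cost of a partial matching. -/
def mCostInf {ι κ : Type*} (x : ι → Pt) (y : κ → Pt) (m : Matching ι κ) : ℝ≥0∞ :=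
  (⨆ i : m.I, ENNReal.ofReal (dist (x i.1) (y (m.e i).1)))
  ⊔ (⨆ i : ↥(m.Iᶜ), ENNReal.ofReal (persDist (x i.1)))
  ⊔ (⨆ j : ↥(m.Jᶜ), ENNReal.ofReal (persDist (y j.1)))

/-- The point measure associated to an indexed family of points. -/
def famMeasure {ι : Type*} (x : ι → Pt) : Measure Pt :=
  Measure.sum (fun i => Measure.dirac (x i))

/-- The weighted measure μ^p, with density d(x,∂Ω)^p with respect to μ. -/
def wgt (p : ℝ) (μ : Measure Pt) : Measure Pt :=
  μ.withDensity (fun x => ENNReal.ofReal (persDist x ^ p))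

/-- The quotient space Ω̃ = Ω ⊔ {∂Ω}. -/
def Qt : Type := Option ↥UHP

/-- The quotient metric ρ on Ω̃. -/
def ρQ : Qt → Qt → ℝ
  | some x, some y => min (dist (x : Pt) (y : Pt)) (persDist x + persDist y)
  | some x, none => persDist x
  | none, some y => persDist y
  | none, none => 0

/-- The quotient metric ρ viewed on the plane, all diagonal points being
identified. -/
def ρP (x y : Pt) : ℝ :=
  if x ∈ Diag then (if y ∈ Diag then 0 else persDist y)
  else if y ∈ Diag then persDist x
  else min (dist x y) (persDist x + persDist y)

/-- Couplings with full (equal-mass) marginals. -/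
def Coup (μ ν : Measure Pt) : Set (Measure (Pt × Pt)) :=
  {π | π.map Prod.fst = μ ∧ π.map Prod.snd = ν}

/-- The p-Wasserstein distance (to the p) for the quotient metric ρ. -/
def WpE (p : ℝ) (μ ν : Measure Pt) : ℝ≥0∞ :=
  ⨅ π ∈ Coup μ ν, ∫⁻ z, ENNReal.ofReal (ρP z.1 z.2 ^ p) ∂π


lemma diag_closed : IsClosed Diag := by
  unfold Diag
  exact isClosed_eq (by fun_prop) (by fun_prop)

lemma uhp_open : IsOpen UHP := by
  unfold UHP
  exact isOpen_lt (by fun_prop) (by fun_prop)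

lemma uhp_meas : MeasurableSet UHP := uhp_open.measurableSet

lemma diag_ne : Diag.Nonempty := ⟨0, by simp [Diag]⟩

lemma persDist_nonneg (x : Pt) : 0 ≤ persDist x := infDist_nonneg

lemma persDist_cont : Continuous persDist := continuous_infDist_pt _

lemma persDist_le (x y : Pt) : persDist x ≤ persDist y + dist x y := infDist_le_infDist_add_dist

lemma persDist_abs (x y : Pt) : |persDist x - persDist y| ≤ dist x y := by
  have h1 := persDist_le x y
  have h2 := persDist_le y x
  rw [dist_comm y x] at h2
  rw [abs_le]; constructor <;> linarith

lemma persDist_pos {x : Pt} (hx : x ∈ UHP) : 0 < persDist x := by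
  unfold persDist
  rw [← diag_closed.notMem_iff_infDist_pos diag_ne]
  intro h
  simp only [Diag, UHP, mem_ofPred_eq] at h hx
  linarith

lemma persDist_diag {x : Pt} (hx : x ∈ Diag) : persDist x = 0 := infDist_zero_of_mem hx

/-- The density of the weighted measure. -/
def dens (p : ℝ) (x : Pt) : ℝ≥0∞ := ENNReal.ofReal (persDist x ^ p)

lemma rpow_cont {p : ℝ} (hp : 1 ≤ p) : Continuous (fun x => persDist x ^ p) :=
  persDist_cont.rpow_const (fun _ => Or.inr (by linarith))

lemma dens_meas {p : ℝ} (hp : 1 ≤ p) : Measurable (dens p) :=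
  (rpow_cont hp).measurable.ennreal_ofReal

lemma wgt_eq (p : ℝ) (μ : Measure Pt) : wgt p μ = μ.withDensity (dens p) := rfl

lemma restrict_uhp {μ : Measure Pt} (h : μ UHPᶜ = 0) : μ.restrict UHP = μ :=
  Measure.restrict_eq_self_of_ae_mem (by rwa [ae_iff])

lemma wgt_compl {p : ℝ} {μ : Measure Pt} (h : MemMp p μ) : wgt p μ UHPᶜ = 0 :=
  withDensity_absolutelyContinuous _ _ h.1

lemma wgt_univ {p : ℝ} {μ : Measure Pt} (h : MemMp p μ) : wgt p μ univ = Pers p μ := by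
  unfold wgt Pers
  rw [withDensity_apply _ MeasurableSet.univ, Measure.restrict_univ, restrict_uhp h.1]

lemma wgt_finite {p : ℝ} {μ : Measure Pt} (h : MemMp p μ) : IsFiniteMeasure (wgt p μ) :=
  ⟨by rw [wgt_univ h]; exact h.2⟩

/-- Projection to the diagonal. -/
def prj (x : Pt) : Pt := WithLp.toLp 2 ![(x 0 + x 1) / 2, (x 0 + x 1) / 2]

lemma prj_mem (x : Pt) : prj x ∈ Diag := by simp [prj, Diag]

lemma prj_meas : Measurable prj := by
  apply Continuous.measurable
  unfold prj
  apply (PiLp.continuous_toLp 2 _).comp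
  apply continuous_pi
  intro i
  fin_cases i <;> simp <;> fun_prop

lemma dist_prj (x : Pt) : dist x (prj x) ≤ persDist x := by
  unfold persDist
  rw [le_infDist diag_ne]
  intro y hy
  simp only [Diag, mem_ofPred_eq] at hy
  rw [EuclideanSpace.dist_eq, EuclideanSpace.dist_eq]
  apply Real.sqrt_le_sqrt
  simp only [Fin.sum_univ_two, Real.dist_eq, sq_abs, prj]
  simp [hy]
  nlinarith [sq_nonneg (x 0 + x 1 - 2 * y 1)]

lemma pow_bound {p : ℝ} (hp : 1 ≤ p) {ε : ℝ} (hε : 0 < ε) :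
    ∃ C : ℝ, 0 ≤ C ∧ ∀ a b : ℝ, 0 ≤ a → 0 ≤ b →
      |a ^ p - b ^ p| ≤ ε * b ^ p + C * |a - b| ^ p := by
  have hc : ContinuousAt (fun t : ℝ => t ^ p) 1 :=
    Real.continuousAt_rpow_const _ _ (Or.inl one_ne_zero)
  rw [Metric.continuousAt_iff] at hc
  obtain ⟨δ, hδ, h⟩ := hc ε hε
  refine ⟨(1 / δ + 1) ^ p, by positivity, fun a b ha hb => ?_⟩
  have hp0 : 0 ≤ p := by linarith
  rcases lt_or_ge |a - b| (δ * b) with h1 | h1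
  · have hb' : 0 < b := by
      by_contra hb'
      have : b = 0 := by linarith
      subst this
      simp at h1
      exact absurd h1 (not_lt.2 (abs_nonneg _))
    have ht : dist (a / b) 1 < δ := by
      rw [Real.dist_eq, div_sub_one hb'.ne', abs_div, abs_of_pos hb', div_lt_iff₀ hb']
      exact h1
    have := h ht
    rw [Real.dist_eq, Real.one_rpow, Real.div_rpow ha hb] at this
    have hbp : 0 < b ^ p := by positivity
    rw [div_sub_one hbp.ne', abs_div, abs_of_pos hbp, div_lt_iff₀ hbp] at this
    have : 0 ≤ (1 / δ + 1) ^ p * |a - b| ^ p := by positivity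
    linarith
  · have hr : 0 ≤ |a - b| := abs_nonneg _
    have hb2 : b ≤ 1 / δ * |a - b| := by
      rw [one_div, inv_mul_eq_div, le_div_iff₀ hδ]; linarith
    have ha2 : a ≤ b + |a - b| := by have := le_abs_self (a - b); linarith
    rw [← Real.mul_rpow (by positivity) hr]
    have h3 : a ^ p ≤ ((1 / δ + 1) * |a - b|) ^ p :=
      Real.rpow_le_rpow ha (by linarith) hp0
    have h4 : b ^ p ≤ ((1 / δ + 1) * |a - b|) ^ p :=
      Real.rpow_le_rpow hb (by linarith) hp0
    have h5 : 0 ≤ a ^ p := by positivity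
    have h6 : 0 ≤ b ^ p := by positivity
    have h7 : 0 ≤ ε * b ^ p := by positivity
    rw [abs_le]; constructor <;> linarith

lemma exists_K {p : ℝ} {μ : Measure Pt} (h : MemMp p μ) {ε : ℝ≥0∞} (hε : ε ≠ 0) :
    ∃ K : Set Pt, IsCompact K ∧ K ⊆ UHP ∧ wgt p μ Kᶜ ≤ ε := by
  have := wgt_finite h
  obtain ⟨K, hKU, hK, hlt⟩ := uhp_meas.exists_isCompact_sdiff_lt (μ := wgt p μ)
    (measure_ne_top _ _) hε
  refine ⟨K, hK, hKU, ?_⟩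
  calc wgt p μ Kᶜ ≤ wgt p μ ((UHP \ K) ∪ UHPᶜ) := by
        apply measure_mono
        intro x hx
        by_cases hxU : x ∈ UHP
        · exact Or.inl ⟨hxU, hx⟩
        · exact Or.inr hxU
    _ ≤ wgt p μ (UHP \ K) + wgt p μ UHPᶜ := measure_union_le _ _
    _ ≤ ε := by rw [wgt_compl h, add_zero]; exact hlt.le

lemma map_fst {μ ν : Measure Pt} {π : Measure (Pt × Pt)} (hπ : π ∈ Adm ν μ) (hν : ν UHPᶜ = 0) :
    (π.map Prod.fst).restrict UHP = ν := by
  rw [← restrict_uhp hν]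
  ext A hA
  rw [Measure.restrict_apply hA, Measure.restrict_apply hA,
    Measure.map_apply measurable_fst (hA.inter uhp_meas),
    ← hπ.2.1 _ (hA.inter uhp_meas) inter_subset_right]
  congr 1
  ext z; simp

lemma map_snd {μ ν : Measure Pt} {π : Measure (Pt × Pt)} (hπ : π ∈ Adm ν μ) (hμ : μ UHPᶜ = 0) :
    (π.map Prod.snd).restrict UHP = μ := by
  rw [← restrict_uhp hμ]
  ext A hA
  rw [Measure.restrict_apply hA, Measure.restrict_apply hA,
    Measure.map_apply measurable_snd (hA.inter uhp_meas),
    ← hπ.2.2 _ (hA.inter uhp_meas) inter_subset_right]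
  congr 1
  ext z; simp

lemma lint_snd {μ ν : Measure Pt} {π : Measure (Pt × Pt)} (hπ : π ∈ Adm ν μ) (hμ : μ UHPᶜ = 0)
    {G : Pt → ℝ≥0∞} (hG : Measurable G) (h0 : ∀ x ∈ Diag, G x = 0) :
    ∫⁻ z, G z.2 ∂π = ∫⁻ x, G x ∂μ := by
  have h1 : ∫⁻ z, G z.2 ∂π = ∫⁻ z, UHP.indicator G z.2 ∂π := by
    apply lintegral_congr_ae
    have : ∀ᵐ z ∂π, z ∈ UHPbar ×ˢ UHPbar := by rw [ae_iff]; exact hπ.1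
    filter_upwards [this] with z hz
    rcases hz.2 with h | h
    · simp [h]
    · by_cases h' : z.2 ∈ UHP
      · simp [h']
      · simp [h', h0 _ h]
  rw [h1, ← lintegral_map (hG.indicator uhp_meas) measurable_snd, lintegral_indicator uhp_meas,
    map_snd hπ hμ]

lemma int_fst {μ ν : Measure Pt} {π : Measure (Pt × Pt)} (hπ : π ∈ Adm ν μ) (hν : ν UHPᶜ = 0)
    {F : Pt → ℝ} (hF : Measurable F) (h0 : ∀ x ∉ UHP, F x = 0) :
    ∫ z, F z.1 ∂π = ∫ x, F x ∂ν := by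
  rw [← integral_map (φ := Prod.fst) measurable_fst.aemeasurable hF.aestronglyMeasurable,
    ← setIntegral_eq_integral_of_forall_compl_eq_zero (s := UHP) h0, map_fst hπ hν]

lemma int_snd {μ ν : Measure Pt} {π : Measure (Pt × Pt)} (hπ : π ∈ Adm ν μ) (hμ : μ UHPᶜ = 0)
    {F : Pt → ℝ} (hF : Measurable F) (h0 : ∀ x ∉ UHP, F x = 0) :
    ∫ z, F z.2 ∂π = ∫ x, F x ∂μ := by
  rw [← integral_map (φ := Prod.snd) measurable_snd.aemeasurable hF.aestronglyMeasurable,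
    ← setIntegral_eq_integral_of_forall_compl_eq_zero (s := UHP) h0, map_snd hπ hμ]

lemma intble_fst {μ ν : Measure Pt} {π : Measure (Pt × Pt)} (hπ : π ∈ Adm ν μ) (hν : ν UHPᶜ = 0)
    {F : Pt → ℝ} (hF : Measurable F) (h0 : ∀ x ∉ UHP, F x = 0) (hi : Integrable F ν) :
    Integrable (fun z => F z.1) π := by
  rw [← map_fst hπ hν] at hi
  have h2 : Integrable F (π.map Prod.fst) := by
    rwa [← IntegrableOn, integrableOn_iff_integrable_of_support_subset] at hi
    intro x hx
    by_contra h
    exact hx (h0 x h)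
  exact h2.comp_measurable measurable_fst

lemma intble_snd {μ ν : Measure Pt} {π : Measure (Pt × Pt)} (hπ : π ∈ Adm ν μ) (hμ : μ UHPᶜ = 0)
    {F : Pt → ℝ} (hF : Measurable F) (h0 : ∀ x ∉ UHP, F x = 0) (hi : Integrable F μ) :
    Integrable (fun z => F z.2) π := by
  rw [← map_snd hπ hμ] at hi
  have h2 : Integrable F (π.map Prod.snd) := by
    rwa [← IntegrableOn, integrableOn_iff_integrable_of_support_subset] at hi
    intro x hx
    by_contra h
    exact hx (h0 x h)
  exact h2.comp_measurable measurable_snd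

lemma int_wgt {p : ℝ} (hp : 1 ≤ p) {μ : Measure Pt} (h : MemMp p μ) (f : Pt → ℝ) :
    ∫ x in UHP, f x ∂(wgt p μ) = ∫ x, persDist x ^ p * UHP.indicator f x ∂μ := by
  rw [← integral_indicator uhp_meas, wgt_eq, integral_withDensity_eq_integral_toReal_smul
    (dens_meas hp) (by simp [dens])]
  apply integral_congr_ae
  filter_upwards with x
  rw [dens, ENNReal.toReal_ofReal (Real.rpow_nonneg (persDist_nonneg _) _), smul_eq_mul]

lemma intble_F {p : ℝ} (hp : 1 ≤ p) {μ : Measure Pt} (h : MemMp p μ) {g : Pt → ℝ}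
    (hg : Measurable g) {C : ℝ} (hC : ∀ x, |g x| ≤ C) :
    Integrable (fun x => persDist x ^ p * g x) μ := by
  have h1 : Integrable (fun x => persDist x ^ p) μ := by
    refine ⟨(rpow_cont hp).measurable.aestronglyMeasurable, ?_⟩
    rw [hasFiniteIntegral_iff_ofReal]
    · have := h.2
      rwa [Pers, restrict_uhp h.1] at this
    · exact Eventually.of_forall fun x => Real.rpow_nonneg (persDist_nonneg _) _
  exact h1.mul_bdd (c := C) hg.aestronglyMeasurable (Eventually.of_forall hC)

lemma indicator_meas {f : Pt → ℝ} (hf : ContinuousOn f UHP) : Measurable (UHP.indicator f) := by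
  have := ContinuousOn.measurable_piecewise (s := UHP) (g := (0 : Pt → ℝ)) hf continuousOn_const uhp_meas
  rwa [piecewise_eq_indicator] at this

/-- pointwise estimate -/
lemma ptwise {p : ℝ} (hp : 1 ≤ p) {g : Pt → ℝ} {C : ℝ} (hC0 : 0 ≤ C) (hC : ∀ x, |g x| ≤ C)
    {K : Set Pt} (hK : IsCompact K) (hg : ∀ x ∈ K, ContinuousAt g x) {ε : ℝ} (hε : 0 < ε) :
    ∃ D : ℝ, 0 ≤ D ∧ ∀ x y : Pt, |persDist x ^ p * g x - persDist y ^ p * g y| ≤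
      (C + 1) * ε * persDist y ^ p + 2 * C * Kᶜ.indicator (fun y => persDist y ^ p) y +
        D * dist x y ^ p := by
  obtain ⟨A, hA0, hA⟩ := pow_bound hp hε
  have hu := hK.uniformContinuousAt_of_continuousAt g hg (Metric.dist_mem_uniformity hε)
  obtain ⟨δ, hδ, hu⟩ := Metric.mem_uniformity_dist.1 hu
  obtain ⟨B, hB⟩ := (hK.image persDist_cont).bddAbove
  have hp0 : 0 ≤ p := by linarith
  refine ⟨C * A + 2 * C * ((max B 0) / δ) ^ p, by positivity, fun x y => ?_⟩
  have e : persDist x ^ p * g x - persDist y ^ p * g y =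
    (persDist x ^ p - persDist y ^ p) * g x + persDist y ^ p * (g x - g y) := by ring
  have hy0 : 0 ≤ persDist y ^ p := Real.rpow_nonneg (persDist_nonneg _) _
  have h1 : |(persDist x ^ p - persDist y ^ p) * g x| ≤
      C * (ε * persDist y ^ p + A * dist x y ^ p) := by
    rw [abs_mul, mul_comm]
    refine mul_le_mul (hC x) ?_ (abs_nonneg _) hC0
    refine (hA _ _ (persDist_nonneg _) (persDist_nonneg _)).trans ?_
    have := Real.rpow_le_rpow (abs_nonneg _) (persDist_abs x y) hp0
    gcongr
  have hgg : |g x - g y| ≤ 2 * C := by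
    have := abs_sub (g x) (g y)
    linarith [hC x, hC y]
  have hd : 0 ≤ dist x y ^ p := by positivity
  have h2 : |persDist y ^ p * (g x - g y)| ≤ ε * persDist y ^ p +
      2 * C * Kᶜ.indicator (fun y => persDist y ^ p) y +
      2 * C * ((max B 0) / δ) ^ p * dist x y ^ p := by
    rw [abs_mul, abs_of_nonneg hy0]
    have h30 : 0 ≤ 2 * C * ((max B 0) / δ) ^ p * dist x y ^ p := by positivity
    have h31 : 0 ≤ ε * persDist y ^ p := by positivity
    by_cases hy : y ∈ K
    · rw [indicator_of_notMem (by simpa using hy)]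
      rcases lt_or_ge (dist x y) δ with hxy | hxy
      · have h4 := hu (a := y) (b := x) (by rwa [dist_comm]) hy
        change dist (g y) (g x) < ε at h4
        rw [dist_comm, Real.dist_eq] at h4
        have : persDist y ^ p * |g x - g y| ≤ persDist y ^ p * ε := by gcongr
        linarith
      · have h5 : persDist y ≤ max B 0 / δ * dist x y := by
          have : persDist y ≤ max B 0 := le_max_of_le_left (hB ⟨y, hy, rfl⟩)
          refine this.trans ?_
          rw [div_mul_eq_mul_div, le_div_iff₀ hδ]
          gcongr
        have h6 := Real.rpow_le_rpow (persDist_nonneg _) h5 hp0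
        rw [Real.mul_rpow (by positivity) dist_nonneg] at h6
        have : persDist y ^ p * |g x - g y| ≤ (max B 0 / δ) ^ p * dist x y ^ p * (2 * C) := by
          gcongr
        linarith
    · rw [indicator_of_mem (by simpa using hy)]
      have : persDist y ^ p * |g x - g y| ≤ persDist y ^ p * (2 * C) := by gcongr
      linarith
  rw [e]
  refine (abs_add_le _ _).trans ?_
  linarith

lemma plan_est {p : ℝ} (hp : 1 ≤ p) {μ ν : Measure Pt} (hμ : MemMp p μ) (hν : MemMp p ν)
    {g : Pt → ℝ} {C : ℝ} (hC : ∀ x, |g x| ≤ C) (hg : Measurable g) (h0 : ∀ x ∉ UHP, g x = 0)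
    {K : Set Pt} (hK : IsCompact K) {a b D : ℝ} (ha : 0 ≤ a) (hb : 0 ≤ b) (hD : 0 ≤ D)
    (hpt : ∀ x y : Pt, |persDist x ^ p * g x - persDist y ^ p * g y| ≤
      a * persDist y ^ p + b * Kᶜ.indicator (fun y => persDist y ^ p) y + D * dist x y ^ p)
    {π : Measure (Pt × Pt)} (hπ : π ∈ Adm ν μ) :
    ENNReal.ofReal |(∫ x, persDist x ^ p * g x ∂ν) - ∫ x, persDist x ^ p * g x ∂μ| ≤
      ENNReal.ofReal a * wgt p μ univ + ENNReal.ofReal b * wgt p μ Kᶜ +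
        ENNReal.ofReal D * Cost p π := by
  have hp0 : 0 ≤ p := by linarith
  have hF : Measurable (fun x => persDist x ^ p * g x) := (rpow_cont hp).measurable.mul hg
  have hF0 : ∀ x ∉ UHP, persDist x ^ p * g x = 0 := fun x hx => by rw [h0 x hx, mul_zero]
  rw [← int_fst hπ hν.1 hF hF0, ← int_snd hπ hμ.1 hF hF0,
    ← integral_sub (intble_fst hπ hν.1 hF hF0 (intble_F hp hν hg hC))
      (intble_snd hπ hμ.1 hF hF0 (intble_F hp hμ hg hC)), ← Real.norm_eq_abs, ofReal_norm]
  refine (enorm_integral_le_lintegral_enorm _).trans ?_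
  have hKm : MeasurableSet Kᶜ := hK.isClosed.measurableSet.compl
  have hdm := dens_meas hp
  have hcm : Measurable (fun z : Pt × Pt => ENNReal.ofReal (dist z.1 z.2 ^ p)) := by
    apply Measurable.ennreal_ofReal
    exact (continuous_dist.rpow_const (fun _ => Or.inr hp0)).measurable
  have hi : Measurable (fun z : Pt × Pt => Kᶜ.indicator (dens p) z.2) :=
    (hdm.indicator hKm).comp measurable_snd
  calc _ ≤ ∫⁻ z : Pt × Pt, ((ENNReal.ofReal a * dens p z.2 +
        ENNReal.ofReal b * Kᶜ.indicator (dens p) z.2) +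
        ENNReal.ofReal D * ENNReal.ofReal (dist z.1 z.2 ^ p)) ∂π := by
        apply lintegral_mono
        intro z
        dsimp only
        rw [← ofReal_norm, Real.norm_eq_abs]
        refine (ENNReal.ofReal_le_ofReal (hpt z.1 z.2)).trans ?_
        have hy0 : 0 ≤ persDist z.2 ^ p := Real.rpow_nonneg (persDist_nonneg _) _
        have hi0 : 0 ≤ Kᶜ.indicator (fun y => persDist y ^ p) z.2 :=
          indicator_nonneg (fun y _ => Real.rpow_nonneg (persDist_nonneg _) _) _
        have hi : ENNReal.ofReal (Kᶜ.indicator (fun y => persDist y ^ p) z.2) =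
            Kᶜ.indicator (dens p) z.2 := by
          by_cases h : z.2 ∈ Kᶜ
          · rw [indicator_of_mem h, indicator_of_mem h]; rfl
          · rw [indicator_of_notMem h, indicator_of_notMem h]; simp
        rw [ENNReal.ofReal_add (by positivity) (by positivity),
          ENNReal.ofReal_add (by positivity) (by positivity), ENNReal.ofReal_mul ha,
          ENNReal.ofReal_mul hb, ENNReal.ofReal_mul hD, hi]
        rfl
    _ = _ := by
        have hd0 : ∀ x ∈ Diag, dens p x = 0 := fun x hx => by
          rw [dens, persDist_diag hx, Real.zero_rpow (by linarith), ENNReal.ofReal_zero]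
        rw [lintegral_add_right _ (by fun_prop), lintegral_add_left (by fun_prop),
          lintegral_const_mul _ (by fun_prop),
          lintegral_const_mul _ hi,
          lintegral_const_mul _ hcm, lint_snd hπ hμ.1 hdm hd0,
          lint_snd hπ hμ.1 (hdm.indicator hKm) (fun x hx => by
            by_cases h : x ∈ Kᶜ
            · rw [indicator_of_mem h, hd0 x hx]
            · rw [indicator_of_notMem h]), lintegral_indicator hKm, wgt_eq,
          withDensity_apply _ hKm, withDensity_apply _ MeasurableSet.univ, Measure.restrict_univ]
        rfl

lemma forward {p : ℝ} (hp : 1 ≤ p) {μ : Measure Pt} {μs : ℕ → Measure Pt}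
    (hμ : MemMp p μ) (hμs : ∀ n, MemMp p (μs n))
    (hT : Tendsto (fun n => OTe p (μs n) μ) atTop (𝓝 0))
    (f : Pt → ℝ) (hf : ContinuousOn f UHP) (hb : ∃ C : ℝ, ∀ x ∈ UHP, |f x| ≤ C) :
    Tendsto (fun n => ∫ x in UHP, f x ∂(wgt p (μs n))) atTop
          (𝓝 (∫ x in UHP, f x ∂(wgt p μ))) := by
  obtain ⟨C', hC'⟩ := hb
  set C := max C' 0 with hCdef
  have hC0 : 0 ≤ C := le_max_right _ _
  set g := UHP.indicator f with hgdef
  have hC : ∀ x, |g x| ≤ C := by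
    intro x
    by_cases h : x ∈ UHP
    · rw [hgdef, indicator_of_mem h]; exact (hC' x h).trans (le_max_left _ _)
    · rw [hgdef, indicator_of_notMem h]; simpa using hC0
  have hg : Measurable g := indicator_meas hf
  have hg0 : ∀ x ∉ UHP, g x = 0 := fun x hx => indicator_of_notMem hx _
  have hgc : ∀ x ∈ UHP, ContinuousAt g x := fun x hx => by
    have h1 := hf.continuousAt (uhp_open.mem_nhds hx)
    refine h1.congr ?_
    filter_upwards [uhp_open.mem_nhds hx] with y hy
    rw [hgdef, indicator_of_mem hy]
  simp_rw [int_wgt hp (hμs _), int_wgt hp hμ]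
  have := wgt_finite hμ
  set M := (wgt p μ univ).toReal with hM
  have hM0 : 0 ≤ M := ENNReal.toReal_nonneg
  rw [Metric.tendsto_atTop']
  intro η hη
  set ε := η / ((C + 1) * M + 2 * C + 2) with hε
  have hden : 0 < (C + 1) * M + 2 * C + 2 := by positivity
  have hε0 : 0 < ε := by positivity
  obtain ⟨K, hK, hKU, hKε⟩ := exists_K hμ (ε := ENNReal.ofReal ε) (by simpa using hε0)
  obtain ⟨D, hD, hpt⟩ := ptwise hp hC0 hC hK (fun x hx => hgc x (hKU hx)) hε0
  have hc : (0 : ℝ≥0∞) < ENNReal.ofReal (ε / (D + 1)) := by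
    rw [ENNReal.ofReal_pos]; positivity
  obtain ⟨N, hN⟩ := eventually_atTop.1 (hT.eventually_lt_const hc)
  refine ⟨N, fun n hn => ?_⟩
  have h1 := hN n hn.le
  simp only [OTe, iInf_lt_iff] at h1
  obtain ⟨π, hπ, hcost⟩ := h1
  have h2 := plan_est hp hμ (hμs n) hC hg hg0 hK (by positivity) (by positivity) hD hpt hπ
  have hu : wgt p μ univ = ENNReal.ofReal M := (ENNReal.ofReal_toReal (measure_ne_top _ _)).symm
  have h3 : ENNReal.ofReal |(∫ x, persDist x ^ p * g x ∂(μs n)) - ∫ x, persDist x ^ p * g x ∂μ| ≤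
      ENNReal.ofReal ((C + 1) * ε * M + 2 * C * ε + D * (ε / (D + 1))) := by
    refine h2.trans ?_
    rw [ENNReal.ofReal_add (by positivity) (by positivity),
      ENNReal.ofReal_add (by positivity) (by positivity),
      ENNReal.ofReal_mul (p := (C + 1) * ε) (by positivity),
      ENNReal.ofReal_mul (p := 2 * C) (by positivity), ENNReal.ofReal_mul hD, hu]
    gcongr
  rw [ENNReal.ofReal_le_ofReal_iff (by positivity)] at h3
  rw [Real.dist_eq]
  refine h3.trans_lt ?_
  have h4 : D * (ε / (D + 1)) ≤ ε := by
    rw [mul_div_assoc', div_le_iff₀ (by positivity)]; nlinarith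
  have h5 : ε * ((C + 1) * M + 2 * C + 2) = η := by rw [hε]; field_simp
  nlinarith

lemma diag_cost {p : ℝ} (hp : 1 ≤ p) {ν : Measure Pt} (hν : MemMp p ν) {a : Pt → ℝ≥0∞}
    (ha : Measurable a) (ha1 : ∀ x, a x ≤ 1) :
    ∫⁻ x, ENNReal.ofReal (dist x (prj x) ^ p) ∂(ν.withDensity (fun x => 1 - a x)) ≤
      wgt p ν univ - ∫⁻ x, a x ∂(wgt p ν) := by
  have hp0 : 0 ≤ p := by linarith
  have := wgt_finite hν
  have hm : Measurable (fun x => 1 - a x) := measurable_const.sub ha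
  have hfin : ∫⁻ x, a x ∂(wgt p ν) ≠ ⊤ := by
    refine ne_top_of_le_ne_top (measure_ne_top (wgt p ν) univ) ?_
    rw [← lintegral_one]
    exact lintegral_mono ha1
  rw [← lintegral_one, ← lintegral_sub ha hfin (Eventually.of_forall ha1), wgt_eq,
    lintegral_withDensity_eq_lintegral_mul _ (dens_meas hp) hm]
  refine (lintegral_mono (g := dens p) fun x => ?_).trans ?_
  · exact ENNReal.ofReal_le_ofReal (Real.rpow_le_rpow dist_nonneg (dist_prj x) hp0)
  · rw [lintegral_withDensity_eq_lintegral_mul _ hm (dens_meas hp)]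
    apply le_of_eq
    congr 1
    rw [mul_comm]

lemma disj {x : Pt} (hx : x ∈ Diag) : x ∉ UHP := by
  intro h
  simp only [Diag, UHP, mem_ofPred_eq] at h hx
  linarith

lemma uhpbar_meas : MeasurableSet UHPbar := uhp_meas.union diag_closed.measurableSet

lemma wd_compl {ν : Measure Pt} (hν : ν UHPᶜ = 0) (f : Pt → ℝ≥0∞) :
    (ν.withDensity f) UHPbarᶜ = 0 := by
  apply withDensity_absolutelyContinuous
  refine measure_mono_null ?_ hν
  exact compl_subset_compl.2 subset_union_left

lemma inv_max_le (a b : ℝ≥0∞) (_ha : a ≠ ⊤) : (max a b)⁻¹ * a ≤ 1 := by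
  calc (max a b)⁻¹ * a ≤ a⁻¹ * a := by gcongr; exact le_max_left _ _
    _ ≤ 1 := ENNReal.inv_mul_le_one a

lemma plan {p : ℝ} (hp : 1 ≤ p) {μ ν : Measure Pt} (hμ : MemMp p μ) (hν : MemMp p ν)
    {ι : Type} [Fintype ι] {φ : ι → Pt → ℝ≥0∞} (hφ : ∀ i, Measurable (φ i))
    (hsum : ∀ x, ∑ i, φ i x ≤ 1) {ε : ℝ} (hε : 0 < ε)
    (hd : ∀ i x y, φ i x ≠ 0 → φ i y ≠ 0 → dist x y ≤ ε * persDist y)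
    (hm : ∀ i, ∫⁻ x, φ i x ∂μ ≠ ⊤) (hm' : ∀ i, ∫⁻ x, φ i x ∂ν ≠ ⊤) :
    OTe p ν μ ≤ ENNReal.ofReal (ε ^ p) * wgt p μ univ +
      (wgt p ν univ - ∑ i, (max (∫⁻ x, φ i x ∂μ) (∫⁻ x, φ i x ∂ν))⁻¹ * (∫⁻ x, φ i x ∂μ) *
        ∫⁻ x, φ i x ∂(wgt p ν)) +
      (wgt p μ univ - ∑ i, (max (∫⁻ x, φ i x ∂μ) (∫⁻ x, φ i x ∂ν))⁻¹ * (∫⁻ x, φ i x ∂ν) *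
        ∫⁻ x, φ i x ∂(wgt p μ)) := by
  have hp0 : 0 ≤ p := by linarith
  set m := fun i => ∫⁻ x, φ i x ∂μ with hmdef
  set m' := fun i => ∫⁻ x, φ i x ∂ν with hmdef'
  set t := fun i => (max (m i) (m' i))⁻¹ with ht
  have hα : ∀ i, t i * m i ≤ 1 := fun i => inv_max_le _ _ (hm i)
  have hβ : ∀ i, t i * m' i ≤ 1 := fun i => by
    simp only [ht]; rw [max_comm]; exact inv_max_le _ _ (hm' i)
  set a := fun x => ∑ i, t i * m i * φ i x with ha
  set b := fun x => ∑ i, t i * m' i * φ i x with hb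
  have ham : Measurable a := Finset.measurable_sum _ fun i _ => (hφ i).const_mul _
  have hbm : Measurable b := Finset.measurable_sum _ fun i _ => (hφ i).const_mul _
  have ha1 : ∀ x, a x ≤ 1 := fun x => (Finset.sum_le_sum fun i _ =>
    mul_le_of_le_one_left' (hα i)).trans (hsum x)
  have hb1 : ∀ x, b x ≤ 1 := fun x => (Finset.sum_le_sum fun i _ =>
    mul_le_of_le_one_left' (hβ i)).trans (hsum x)
  have hfμ : ∀ i, IsFiniteMeasure (μ.withDensity (φ i)) := fun i => isFiniteMeasure_withDensity (hm i)
  have hfν : ∀ i, IsFiniteMeasure (ν.withDensity (φ i)) := fun i => isFiniteMeasure_withDensity (hm' i)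
  have hμu : ∀ i, (μ.withDensity (φ i)) univ = m i := fun i => by
    rw [withDensity_apply _ MeasurableSet.univ, Measure.restrict_univ]
  have hνu : ∀ i, (ν.withDensity (φ i)) univ = m' i := fun i => by
    rw [withDensity_apply _ MeasurableSet.univ, Measure.restrict_univ]
  have hmap1 : Measurable (fun x : Pt => (x, prj x)) := measurable_id.prodMk prj_meas
  have hmap2 : Measurable (fun x : Pt => (prj x, x)) := prj_meas.prodMk measurable_id
  set P : Measure (Pt × Pt) := ∑ i, t i • ((ν.withDensity (φ i)).prod (μ.withDensity (φ i))) with hP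
  set R1 : Measure (Pt × Pt) := (ν.withDensity (fun x => 1 - a x)).map (fun x => (x, prj x)) with hR1
  set R2 : Measure (Pt × Pt) := (μ.withDensity (fun x => 1 - b x)).map (fun x => (prj x, x)) with hR2
  have hbb : MeasurableSet (UHPbar ×ˢ UHPbar)ᶜ := (uhpbar_meas.prod uhpbar_meas).compl
  have hadm : P + R1 + R2 ∈ Adm ν μ := by
    refine ⟨?_, ?_, ?_⟩
    · simp only [Measure.add_apply, hP, Measure.finsetSum_apply, Measure.smul_apply, smul_eq_mul,
        add_eq_zero, Finset.sum_eq_zero_iff]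
      refine ⟨⟨fun i _ => ?_, ?_⟩, ?_⟩
      · rw [mul_eq_zero]; right
        rw [compl_prod_eq_union]
        refine measure_union_null ?_ ?_
        · rw [Measure.prod_prod, wd_compl hν.1, zero_mul]
        · rw [Measure.prod_prod, wd_compl hμ.1, mul_zero]
      · rw [hR1, Measure.map_apply hmap1 hbb]
        refine measure_mono_null ?_ (wd_compl hν.1 (fun x => 1 - a x))
        intro x hx hx'
        exact hx ⟨hx', Or.inr (prj_mem x)⟩
      · rw [hR2, Measure.map_apply hmap2 hbb]
        refine measure_mono_null ?_ (wd_compl hμ.1 (fun x => 1 - b x))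
        intro x hx hx'
        exact hx ⟨Or.inr (prj_mem x), hx'⟩
    · intro A hA hAU
      simp only [Measure.add_apply, hP, Measure.finsetSum_apply, Measure.smul_apply, smul_eq_mul,
        Measure.prod_prod, hμu]
      rw [hR1, hR2, Measure.map_apply hmap1 (hA.prod MeasurableSet.univ),
        Measure.map_apply hmap2 (hA.prod MeasurableSet.univ)]
      have e2 : (fun x => (prj x, x)) ⁻¹' (A ×ˢ (univ : Set Pt)) = ∅ := by
        ext x
        simp only [mem_preimage, mem_prod, mem_univ, and_true, mem_empty_iff_false, iff_false]
        exact fun h => disj (prj_mem x) (hAU h)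
      have e1 : (fun x => (x, prj x)) ⁻¹' (A ×ˢ (univ : Set Pt)) = A := by ext x; simp
      rw [e1, e2, measure_empty, add_zero, withDensity_apply _ hA]
      have e3 : ∑ i, t i * ((ν.withDensity (φ i)) A * m i) = ∫⁻ x in A, a x ∂ν := by
        simp only [ha]
        rw [lintegral_finsetSum _ fun i _ => (hφ i).const_mul _]
        refine Finset.sum_congr rfl fun i _ => ?_
        rw [lintegral_const_mul _ (hφ i), withDensity_apply _ hA]
        ring
      rw [e3, ← lintegral_add_left ham]
      simp only [fun x => add_tsub_cancel_of_le (ha1 x)]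
      rw [lintegral_one, Measure.restrict_apply_univ]
    · intro A hA hAU
      simp only [Measure.add_apply, hP, Measure.finsetSum_apply, Measure.smul_apply, smul_eq_mul,
        Measure.prod_prod, hνu]
      rw [hR1, hR2, Measure.map_apply hmap1 (MeasurableSet.univ.prod hA),
        Measure.map_apply hmap2 (MeasurableSet.univ.prod hA)]
      have e2 : (fun x => (x, prj x)) ⁻¹' ((univ : Set Pt) ×ˢ A) = ∅ := by
        ext x
        simp only [mem_preimage, mem_prod, mem_univ, true_and, mem_empty_iff_false, iff_false]
        exact fun h => disj (prj_mem x) (hAU h)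
      have e1 : (fun x => (prj x, x)) ⁻¹' ((univ : Set Pt) ×ˢ A) = A := by ext x; simp
      rw [e1, e2, measure_empty, add_zero, withDensity_apply _ hA]
      have e3 : ∑ i, t i * (m' i * (μ.withDensity (φ i)) A) = ∫⁻ x in A, b x ∂μ := by
        simp only [hb]
        rw [lintegral_finsetSum _ fun i _ => (hφ i).const_mul _]
        refine Finset.sum_congr rfl fun i _ => ?_
        rw [lintegral_const_mul _ (hφ i), withDensity_apply _ hA]
        ring
      rw [e3, ← lintegral_add_left hbm]
      simp only [fun x => add_tsub_cancel_of_le (hb1 x)]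
      rw [lintegral_one, Measure.restrict_apply_univ]
  have hcm : Measurable (fun z : Pt × Pt => ENNReal.ofReal (dist z.1 z.2 ^ p)) := by
    apply Measurable.ennreal_ofReal
    exact (continuous_dist.rpow_const (fun _ => Or.inr hp0)).measurable
  refine (iInf₂_le _ hadm).trans ?_
  simp only [Cost, lintegral_add_measure]
  refine add_le_add (add_le_add ?_ ?_) ?_
  · rw [hP, lintegral_finsetSum_measure]
    calc _ ≤ ∑ i, ENNReal.ofReal (ε ^ p) * ∫⁻ y, φ i y ∂(wgt p μ) := by
          refine Finset.sum_le_sum fun i _ => ?_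
          rw [lintegral_smul_measure, smul_eq_mul, lintegral_prod _ hcm.aemeasurable]
          have key : ∀ x, φ i x ≠ 0 → ∫⁻ y, ENNReal.ofReal (dist x y ^ p) ∂(μ.withDensity (φ i)) ≤
              ENNReal.ofReal (ε ^ p) * ∫⁻ y, φ i y ∂(wgt p μ) := by
            intro x hx
            rw [lintegral_withDensity_eq_lintegral_mul _ (hφ i) (by fun_prop), wgt_eq,
              lintegral_withDensity_eq_lintegral_mul _ (dens_meas hp) (hφ i),
              ← lintegral_const_mul _ ((dens_meas hp).mul (hφ i))]
            refine lintegral_mono fun y => ?_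
            simp only [Pi.mul_apply]
            by_cases hy : φ i y = 0
            · simp [hy]
            · rw [mul_comm, ← mul_assoc]
              gcongr
              rw [dens, ← ENNReal.ofReal_mul (by positivity),
                ← Real.mul_rpow hε.le (persDist_nonneg _)]
              exact ENNReal.ofReal_le_ofReal (Real.rpow_le_rpow dist_nonneg (hd i x y hx hy) hp0)
          have hae : ∀ᵐ x ∂(ν.withDensity (φ i)), φ i x ≠ 0 := by
            rw [ae_withDensity_iff (hφ i)]
            exact Eventually.of_forall fun x h => h
          have : ∫⁻ x, ∫⁻ y, ENNReal.ofReal (dist x y ^ p) ∂(μ.withDensity (φ i))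
              ∂(ν.withDensity (φ i)) ≤
              ENNReal.ofReal (ε ^ p) * (∫⁻ y, φ i y ∂(wgt p μ)) * m' i := by
            rw [← hνu i, ← lintegral_const]
            exact lintegral_mono_ae (hae.mono key)
          calc _ ≤ t i * (ENNReal.ofReal (ε ^ p) * (∫⁻ y, φ i y ∂(wgt p μ)) * m' i) := by
                gcongr
            _ = (t i * m' i) * (ENNReal.ofReal (ε ^ p) * (∫⁻ y, φ i y ∂(wgt p μ))) := by ring
            _ ≤ _ := mul_le_of_le_one_left' (hβ i)
      _ = ENNReal.ofReal (ε ^ p) * ∫⁻ y, ∑ i, φ i y ∂(wgt p μ) := by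
          rw [← Finset.mul_sum, lintegral_finsetSum _ fun i _ => hφ i]
      _ ≤ _ := by
          rw [← lintegral_one]
          gcongr with y
          exact hsum y
  · rw [hR1, lintegral_map hcm hmap1]
    refine (diag_cost hp hν ham ha1).trans (le_of_eq ?_)
    simp only [ha]
    rw [lintegral_finsetSum _ fun i _ => (hφ i).const_mul _]
    simp only [fun i => lintegral_const_mul (μ := wgt p ν) (t i * m i) (hφ i)]
    rfl
  · rw [hR2, lintegral_map hcm hmap2]
    simp only [dist_comm (prj _)]
    refine (diag_cost hp hμ hbm hb1).trans (le_of_eq ?_)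
    simp only [hb]
    rw [lintegral_finsetSum _ fun i _ => (hφ i).const_mul _]
    simp only [fun i => lintegral_const_mul (μ := wgt p μ) (t i * m' i) (hφ i)]
    rfl

lemma coef_tendsto {m u : ℝ≥0∞} {m' u' : ℕ → ℝ≥0∞} (hm : m ≠ ⊤) (hu : u ≠ ⊤)
    (h1 : Tendsto m' atTop (𝓝 m)) (h2 : Tendsto u' atTop (𝓝 u)) (h0 : m = 0 → u = 0) :
    Tendsto (fun n => (max m (m' n))⁻¹ * m * u' n) atTop (𝓝 u) ∧
    Tendsto (fun n => (max m (m' n))⁻¹ * m' n * u) atTop (𝓝 u) := by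
  by_cases h : m = 0
  · have := h0 h
    subst this
    subst h
    refine ⟨?_, by simp⟩
    simp
  · have hmax : Tendsto (fun n => (max m (m' n))⁻¹) atTop (𝓝 m⁻¹) := by
      have : Tendsto (fun n => max m (m' n)) atTop (𝓝 (max m m)) := tendsto_const_nhds.max h1
      rw [max_self] at this
      exact _root_.tendsto_inv_iff.2 this
    constructor
    · have h3 := ENNReal.Tendsto.mul (ENNReal.Tendsto.mul hmax (Or.inr hm)
        (tendsto_const_nhds (x := m)) (Or.inl h)) (by simp [ENNReal.inv_mul_cancel h hm]) h2
        (by simp [ENNReal.inv_mul_cancel h hm])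
      rwa [ENNReal.inv_mul_cancel h hm, one_mul] at h3
    · have h3 := ENNReal.Tendsto.mul (ENNReal.Tendsto.mul hmax (Or.inr hm) h1 (Or.inl h))
        (by simp [ENNReal.inv_mul_cancel h hm]) (tendsto_const_nhds (x := u))
        (by simp [ENNReal.inv_mul_cancel h hm])
      rwa [ENNReal.inv_mul_cancel h hm, one_mul] at h3

lemma lint_eq {p : ℝ} {μ : Measure Pt} (hμ : MemMp p μ) {g : Pt → ℝ} (hg : ContinuousOn g UHP)
    (h0 : ∀ x, 0 ≤ g x) {C : ℝ} (hC : ∀ x ∈ UHP, g x ≤ C) :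
    ∫⁻ x, ENNReal.ofReal (g x) ∂(wgt p μ) = ENNReal.ofReal (∫ x in UHP, g x ∂(wgt p μ)) := by
  have := wgt_finite hμ
  rw [ofReal_integral_eq_lintegral_ofReal _ (Eventually.of_forall h0), restrict_uhp (wgt_compl hμ)]
  refine Integrable.of_bound (hg.aestronglyMeasurable uhp_meas) C ?_
  filter_upwards [ae_restrict_mem uhp_meas] with x hx
  rw [Real.norm_eq_abs, abs_of_nonneg (h0 x)]
  exact hC x hx

lemma unweight {p : ℝ} (hp : 1 ≤ p) {μ : Measure Pt} (hμ : MemMp p μ) {g : Pt → ℝ}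
    (hg : Measurable g) :
    ∫⁻ x, ENNReal.ofReal (g x) ∂μ = ∫⁻ x, ENNReal.ofReal (g x * (persDist x ^ p)⁻¹) ∂(wgt p μ) := by
  have hm : Measurable (fun x => ENNReal.ofReal (g x * (persDist x ^ p)⁻¹)) :=
    (hg.mul (rpow_cont hp).measurable.inv).ennreal_ofReal
  rw [wgt_eq, lintegral_withDensity_eq_lintegral_mul _ (dens_meas hp) hm]
  apply lintegral_congr_ae
  have : ∀ᵐ x ∂μ, x ∈ UHP := by rw [ae_iff]; exact hμ.1
  filter_upwards [this] with x hx
  have h1 : 0 < persDist x ^ p := Real.rpow_pos_of_pos (persDist_pos hx) _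
  rw [Pi.mul_apply, dens, ← ENNReal.ofReal_mul h1.le]
  congr 1
  field_simp

lemma backward {p : ℝ} (hp : 1 ≤ p) {μ : Measure Pt} {μs : ℕ → Measure Pt}
    (hμ : MemMp p μ) (hμs : ∀ n, MemMp p (μs n))
    (hw : ∀ f : Pt → ℝ, ContinuousOn f UHP → (∃ C : ℝ, ∀ x ∈ UHP, |f x| ≤ C) →
        Tendsto (fun n => ∫ x in UHP, f x ∂(wgt p (μs n))) atTop
          (𝓝 (∫ x in UHP, f x ∂(wgt p μ)))) :
    Tendsto (fun n => OTe p (μs n) μ) atTop (𝓝 0) := by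
  have hp0 : 0 < p := by linarith
  have := wgt_finite hμ
  have conv : ∀ (g : Pt → ℝ), ContinuousOn g UHP → (∀ x, 0 ≤ g x) → ∀ C, (∀ x ∈ UHP, g x ≤ C) →
      Tendsto (fun n => ∫⁻ x, ENNReal.ofReal (g x) ∂(wgt p (μs n))) atTop
        (𝓝 (∫⁻ x, ENNReal.ofReal (g x) ∂(wgt p μ))) := by
    intro g hg h0 C hC
    simp_rw [fun n => lint_eq (hμs n) hg h0 hC, lint_eq hμ hg h0 hC]
    refine ENNReal.tendsto_ofReal (hw g hg ⟨C, fun x hx => ?_⟩)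
    rw [abs_of_nonneg (h0 x)]
    exact hC x hx
  have hM : Tendsto (fun n => wgt p (μs n) univ) atTop (𝓝 (wgt p μ univ)) := by
    have := conv (fun _ => 1) continuousOn_const (fun _ => zero_le_one) 1 (fun _ _ => le_rfl)
    simpa using this
  rw [ENNReal.tendsto_nhds_zero]
  intro ε hε
  obtain ⟨ε', hε'0, hε'⟩ := ENNReal.lt_iff_exists_nnreal_btwn.1 hε
  have hthird : (0 : ℝ≥0∞) < (ε' : ℝ≥0∞) / 3 := ENNReal.div_pos hε'0.ne' (by simp)
  obtain ⟨e, he0, he1, heM⟩ : ∃ e : ℝ, 0 < e ∧ e ≤ 1 ∧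
      ENNReal.ofReal (e ^ p) * wgt p μ univ ≤ (ε' : ℝ≥0∞) / 3 := by
    have hc : Continuous (fun e : ℝ => ENNReal.ofReal (e ^ p)) :=
      ENNReal.continuous_ofReal.comp (continuous_id.rpow_const (fun _ => Or.inr hp0.le))
    have h1 : Tendsto (fun e : ℝ => ENNReal.ofReal (e ^ p) * wgt p μ univ) (𝓝[>] 0) (𝓝 0) := by
      have h2 : Tendsto (fun e : ℝ => ENNReal.ofReal (e ^ p)) (𝓝[>] 0) (𝓝 0) := by
        have := hc.tendsto 0
        rw [Real.zero_rpow hp0.ne', ENNReal.ofReal_zero] at this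
        exact this.mono_left nhdsWithin_le_nhds
      have h3 := ENNReal.Tendsto.mul_const h2 (b := wgt p μ univ) (Or.inr (measure_ne_top _ _))
      rwa [zero_mul] at h3
    have h4 : ∀ᶠ e : ℝ in 𝓝[>] 0, e ∈ Ioc (0 : ℝ) 1 := Ioc_mem_nhdsGT zero_lt_one
    obtain ⟨e, h5, h6⟩ := ((ENNReal.tendsto_nhds_zero.1 h1 _ hthird).and h4).exists
    exact ⟨e, h6.1, h6.2, h5⟩
  obtain ⟨K, hK, hKU, hKε⟩ := exists_K hμ hthird.ne'
  obtain ⟨s, hsK, hs⟩ := hK.elim_nhds_subcover (fun x => ball x (e / 4 * persDist x))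
    (fun x hx => ball_mem_nhds _ (mul_pos (by linarith) (persDist_pos (hKU hx))))
  obtain ⟨F, hF⟩ := PartitionOfUnity.exists_isSubordinate hK.isClosed
    (fun i : s => ball (i : Pt) (e / 4 * persDist i)) (fun _ => isOpen_ball) (by
      intro x hx
      obtain ⟨i, hi, hxi⟩ := mem_iUnion₂.1 (hs hx)
      exact mem_iUnion.2 ⟨⟨i, hi⟩, hxi⟩)
  have hmem : ∀ (i : s) x, F i x ≠ 0 → dist x (i : Pt) < e / 4 * persDist i := by
    intro i x hx
    exact hF i (subset_tsupport _ hx)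
  have hpi : ∀ i : s, 0 < persDist i := fun i => persDist_pos (hKU (hsK _ i.2))
  have hlow : ∀ (i : s) x, F i x ≠ 0 → 3 / 4 * persDist i ≤ persDist x := by
    intro i x hx
    have h1 := hmem i x hx
    have h2 := persDist_le i x
    rw [dist_comm] at h2
    nlinarith [hpi i]
  set φ : s → Pt → ℝ≥0∞ := fun i x => ENNReal.ofReal (F i x) with hφ
  have hFm : ∀ i, Measurable (F i) := fun i => (F i).continuous.measurable
  have hφm : ∀ i, Measurable (φ i) := fun i => (hFm i).ennreal_ofReal
  have hsumeq : ∀ x, ∑ i, φ i x = ENNReal.ofReal (∑ᶠ i, F i x) := fun x => by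
    rw [finsum_eq_sum_of_fintype, ENNReal.ofReal_sum_of_nonneg (fun i _ => F.nonneg i x)]
  have hsum : ∀ x, ∑ i, φ i x ≤ 1 := fun x => by
    rw [hsumeq, ENNReal.ofReal_le_one]
    exact F.sum_le_one x
  have hφ0 : ∀ i x, φ i x ≠ 0 → F i x ≠ 0 := fun i x h h' => h (by simp [hφ, h'])
  have hd : ∀ i x y, φ i x ≠ 0 → φ i y ≠ 0 → dist x y ≤ e * persDist y := by
    intro i x y hx hy
    have h1 := hmem i x (hφ0 i x hx)
    have h2 := hmem i y (hφ0 i y hy)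
    have h3 := hlow i y (hφ0 i y hy)
    have h4 := dist_triangle_right x y (i : Pt)
    nlinarith [hpi i, mul_le_mul_of_nonneg_left h3 he0.le, mul_pos he0 (hpi i)]
  have hGc : ∀ i, ContinuousOn (fun x => F i x * (persDist x ^ p)⁻¹) UHP := fun i =>
    (F i).continuous.continuousOn.mul ((rpow_cont hp).continuousOn.inv₀
      (fun x hx => (Real.rpow_pos_of_pos (persDist_pos hx) _).ne'))
  have hG0 : ∀ i x, 0 ≤ F i x * (persDist x ^ p)⁻¹ := fun i x =>
    mul_nonneg (F.nonneg i x) (inv_nonneg.2 (Real.rpow_nonneg (persDist_nonneg _) _))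
  have hGb : ∀ i, ∀ x ∈ UHP, F i x * (persDist x ^ p)⁻¹ ≤ ((3 / 4 * persDist (i : Pt)) ^ p)⁻¹ := by
    intro i x hx
    have hc : 0 < 3 / 4 * persDist (i : Pt) := mul_pos (by norm_num) (hpi i)
    have hcp : 0 < (3 / 4 * persDist (i : Pt)) ^ p := Real.rpow_pos_of_pos hc _
    by_cases h : F i x = 0
    · rw [h, zero_mul]; exact (inv_pos.2 hcp).le
    · have h1 : (persDist x ^ p)⁻¹ ≤ ((3 / 4 * persDist (i : Pt)) ^ p)⁻¹ :=
        inv_anti₀ hcp (Real.rpow_le_rpow hc.le (hlow i x h) hp0.le)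
      have h2 : 0 ≤ (persDist x ^ p)⁻¹ := inv_nonneg.2 (Real.rpow_nonneg (persDist_nonneg _) _)
      calc _ ≤ 1 * (persDist x ^ p)⁻¹ := mul_le_mul_of_nonneg_right (F.le_one i x) h2
        _ ≤ _ := by rw [one_mul]; exact h1
  have hmfin : ∀ (i : s) (ν : Measure Pt), MemMp p ν → ∫⁻ x, φ i x ∂ν ≠ ⊤ := by
    intro i ν hν
    simp only [hφ]
    rw [unweight hp hν (hFm i), lint_eq hν (hGc i) (hG0 i) (hGb i)]
    exact ENNReal.ofReal_ne_top
  have hmT : ∀ i, Tendsto (fun n => ∫⁻ x, φ i x ∂(μs n)) atTop (𝓝 (∫⁻ x, φ i x ∂μ)) := by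
    intro i
    simp only [hφ]
    simp_rw [fun n => unweight hp (hμs n) (hFm i), unweight hp hμ (hFm i)]
    exact conv _ (hGc i) (hG0 i) _ (hGb i)
  have huT : ∀ i, Tendsto (fun n => ∫⁻ x, φ i x ∂(wgt p (μs n))) atTop
      (𝓝 (∫⁻ x, φ i x ∂(wgt p μ))) := fun i =>
    conv _ (F i).continuous.continuousOn (F.nonneg i) 1 (fun x _ => F.le_one i x)
  have hufin : ∀ i, ∫⁻ x, φ i x ∂(wgt p μ) ≠ ⊤ := by
    intro i
    simp only [hφ]
    rw [lint_eq hμ (F i).continuous.continuousOn (F.nonneg i) (C := 1) (fun x _ => F.le_one i x)]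
    exact ENNReal.ofReal_ne_top
  have hu0 : ∀ i, ∫⁻ x, φ i x ∂μ = 0 → ∫⁻ x, φ i x ∂(wgt p μ) = 0 := by
    intro i h
    rw [lintegral_eq_zero_iff (hφm i)] at h ⊢
    exact (withDensity_absolutelyContinuous _ _).ae_le h
  have hco := fun i => coef_tendsto (hmfin i μ hμ) (hufin i) (hmT i) (huT i) (hu0 i)
  have hrest : wgt p μ univ - ∑ i, ∫⁻ x, φ i x ∂(wgt p μ) ≤ (ε' : ℝ≥0∞) / 3 := by
    rw [tsub_le_iff_right, ← lintegral_finsetSum _ fun i _ => hφm i]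
    rw [← measure_add_measure_compl hK.isClosed.measurableSet, add_comm]
    refine add_le_add hKε ?_
    rw [← lintegral_indicator_one hK.isClosed.measurableSet]
    refine lintegral_mono fun x => ?_
    by_cases hx : x ∈ K
    · dsimp only
      rw [indicator_of_mem hx, hsumeq, F.sum_eq_one hx]; simp
    · dsimp only
      rw [indicator_of_notMem hx]; exact zero_le
  have hlim := ((tendsto_const_nhds (x := ENNReal.ofReal (e ^ p) * wgt p μ univ)
    (f := (atTop : Filter ℕ))).add
      (ENNReal.Tendsto.sub hM (tendsto_finsetSum Finset.univ fun i _ => (hco i).1)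
        (Or.inl (measure_ne_top _ _)))).add
      (ENNReal.Tendsto.sub (tendsto_const_nhds (x := wgt p μ univ))
        (tendsto_finsetSum Finset.univ fun i _ => (hco i).2) (Or.inl (measure_ne_top _ _)))
  have hlt : ENNReal.ofReal (e ^ p) * wgt p μ univ +
      (wgt p μ univ - ∑ i, ∫⁻ x, φ i x ∂(wgt p μ)) +
      (wgt p μ univ - ∑ i, ∫⁻ x, φ i x ∂(wgt p μ)) < ε := by
    refine lt_of_le_of_lt ?_ hε'
    rw [← ENNReal.add_thirds (ε' : ℝ≥0∞)]
    exact add_le_add (add_le_add heM hrest) hrest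
  filter_upwards [hlim.eventually_lt_const hlt] with n hn
  exact (plan hp hμ (hμs n) hφm hsum he0 hd (fun i => hmfin i μ hμ)
    (fun i => hmfin i _ (hμs n))).trans hn.le

/-- OT_p(μ_n,μ) → 0 iff the weighted measures μ_n^p converge weakly
(against bounded continuous functions on Ω) to μ^p. -/
theorem stmt9 (p : ℝ) (hp : 1 ≤ p) (μ : Measure Pt) (μs : ℕ → Measure Pt)
    (hμ : MemMp p μ) (hμs : ∀ n, MemMp p (μs n)) :
    Tendsto (fun n => OTe p (μs n) μ) atTop (𝓝 0) ↔
      (∀ f : Pt → ℝ, ContinuousOn f UHP → (∃ C : ℝ, ∀ x ∈ UHP, |f x| ≤ C) →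
        Tendsto (fun n => ∫ x in UHP, f x ∂(wgt p (μs n))) atTop
          (𝓝 (∫ x in UHP, f x ∂(wgt p μ)))) := by
  exact ⟨fun h f hf hb => forward hp hμ hμs h f hf hb, fun h => backward hp hμ hμs h⟩
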